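/- Let $H \in (0, 1/2)$. For $T > 0$ and $x, u \in [0,T]$ define $\varphi_4(x,u) := \int_x^T \big( t^{2H-1} \, \mathrm{sgn}(x+u-t)|x+u-t|^{2H-1} - (t-x)^{2H-1} \, \mathrm{sgn}(u-t)|u-t|^{2H-1} \big) dt$. Then $\limsup_{T \to \infty} T^{3-4H} \, \Big| \int_{[0,T]^2} e^{-u-x} \varphi_4(x,u) \, dx \, du - \tfrac{1}{2} \Gamma(2H)^2 \sigma_H^2 \Big| \leq \frac{1-2H}{3-4H}$. -/

import Mathlib

open MeasureTheory Real Filter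

/-- The convolution of `g` with the exponential kernel `exp (-r)` on `[0, t]`. -/
noncomputable def expConv (g : ℝ → ℝ) (t : ℝ) : ℝ :=
  Real.exp (-t) * ∫ r in (0:ℝ)..t, Real.exp r * g r

theorem intervalIntegrable_exp_mul {g : ℝ → ℝ} (hg : ∀ x y, IntervalIntegrable g volume x y)
    (x y : ℝ) : IntervalIntegrable (fun r => Real.exp r * g r) volume x y :=
  (hg x y).continuousOn_mul Real.continuous_exp.continuousOn

theorem continuous_expConv {g : ℝ → ℝ} (hg : ∀ x y, IntervalIntegrable g volume x y) :
    Continuous (expConv g) := by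
  unfold expConv
  exact (Real.continuous_exp.comp continuous_neg).mul
    (intervalIntegral.continuous_primitive (intervalIntegrable_exp_mul hg) 0)

theorem hasDerivAt_expConv {g : ℝ → ℝ} (hg : ∀ x y, IntervalIntegrable g volume x y)
    (hm : Measurable g) {t : ℝ} (hc : ContinuousAt g t) :
    HasDerivAt (expConv g) (g t - expConv g t) t := by
  have h1 : HasDerivAt (fun t => ∫ r in (0:ℝ)..t, Real.exp r * g r) (Real.exp t * g t) t :=
    intervalIntegral.integral_hasDerivAt_right (intervalIntegrable_exp_mul hg 0 t)
      ((Real.measurable_exp.mul hm).stronglyMeasurable.stronglyMeasurableAtFilter)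
      (Real.continuous_exp.continuousAt.mul hc)
  have h2 : HasDerivAt (fun t => Real.exp (-t)) (-Real.exp (-t)) t := by
    simpa using (hasDerivAt_neg t).exp
  refine (h2.mul h1).congr_deriv ?_
  have : Real.exp (-t) * Real.exp t = 1 := by rw [← Real.exp_add]; simp
  unfold expConv
  linear_combination (g t) * this

theorem expConv_zero (g : ℝ → ℝ) : expConv g 0 = 0 := by simp [expConv]

/-- One half of L'Hôpital's rule for a denominator tending to infinity. -/
theorem eventually_div_lt_of_deriv_div {f g f' g' : ℝ → ℝ} {c d : ℝ} (hcd : c < d)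
    (hf : ∀ᶠ x in atTop, HasDerivAt f (f' x) x) (hg : ∀ᶠ x in atTop, HasDerivAt g (g' x) x)
    (hg' : ∀ᶠ x in atTop, 0 < g' x) (hgt : Tendsto g atTop atTop)
    (h : Tendsto (fun x => f' x / g' x) atTop (nhds c)) :
    ∀ᶠ x in atTop, f x / g x < d := by
  obtain ⟨e, hce, hed⟩ := exists_between hcd
  obtain ⟨x₀, h0⟩ := eventually_atTop.1
    (hf.and (hg.and (hg'.and (h.eventually (gt_mem_nhds hce)))))
  have hanti : AntitoneOn (fun x => f x - e * g x) (Set.Ici x₀) := by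
    refine antitoneOn_of_hasDerivWithinAt_nonpos (convex_Ici x₀) (f' := fun x => f' x - e * g' x)
      ?_ ?_ ?_
    · intro x hx
      exact ((h0 x hx).1.sub ((h0 x hx).2.1.const_mul e)).continuousAt.continuousWithinAt
    · intro x hx
      rw [interior_Ici] at hx
      exact ((h0 x hx.le).1.sub ((h0 x hx.le).2.1.const_mul e)).hasDerivWithinAt
    · intro x hx
      rw [interior_Ici] at hx
      have h1 := h0 x hx.le
      have := (div_lt_iff₀ h1.2.2.1).1 h1.2.2.2
      linarith
  have hlim : Tendsto (fun x => (f x₀ - e * g x₀) / g x) atTop (nhds 0) :=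
    hgt.const_div_atTop _
  filter_upwards [eventually_ge_atTop x₀, hgt.eventually_gt_atTop 0,
    hlim.eventually (gt_mem_nhds (sub_pos.2 hed))] with x hx hgx hl
  have h1 := hanti Set.self_mem_Ici (Set.mem_Ici.2 hx) hx
  simp only at h1
  rw [div_lt_iff₀ hgx] at hl ⊢
  linarith

/-- L'Hôpital's rule for a denominator tending to infinity. -/
theorem tendsto_div_of_deriv_div {f g f' g' : ℝ → ℝ} {c : ℝ}
    (hf : ∀ᶠ x in atTop, HasDerivAt f (f' x) x) (hg : ∀ᶠ x in atTop, HasDerivAt g (g' x) x)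
    (hg' : ∀ᶠ x in atTop, 0 < g' x) (hgt : Tendsto g atTop atTop)
    (h : Tendsto (fun x => f' x / g' x) atTop (nhds c)) :
    Tendsto (fun x => f x / g x) atTop (nhds c) := by
  rw [tendsto_order]
  refine ⟨fun d hd => ?_, fun d hd => eventually_div_lt_of_deriv_div hd hf hg hg' hgt h⟩
  have := eventually_div_lt_of_deriv_div (f := fun x => -f x) (f' := fun x => -f' x)
    (neg_lt_neg hd) (hf.mono fun x hx => hx.neg) hg hg' hgt (by simpa [neg_div] using h.neg)
  filter_upwards [this] with x hx
  rw [neg_div] at hx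
  linarith

/-- Solutions of `y' + y = h` inherit power asymptotics from `h`. -/
theorem tendsto_mul_rpow_of_ode {y h : ℝ → ℝ} {b c : ℝ}
    (hy : ∀ t, 0 < t → HasDerivAt y (h t - y t) t)
    (hh : Tendsto (fun t => h t * t ^ b) atTop (nhds c)) :
    Tendsto (fun t => y t * t ^ b) atTop (nhds c) := by
  have hq : Tendsto (fun t : ℝ => 1 - b / t) atTop (nhds 1) := by
    simpa using tendsto_const_nhds.sub ((tendsto_id (α := ℝ)).const_div_atTop b)
  have key := tendsto_div_of_deriv_div (c := c) (f := fun t => Real.exp t * y t)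
    (f' := fun t => Real.exp t * h t) (g := fun t => Real.exp t * t ^ (-b))
    (g' := fun t => Real.exp t * t ^ (-b) * (1 - b / t)) ?_ ?_ ?_ ?_ ?_
  · refine key.congr' ?_
    filter_upwards [eventually_gt_atTop 0] with t ht
    rw [mul_div_mul_left _ _ (Real.exp_ne_zero t), rpow_neg ht.le, div_inv_eq_mul]
  · filter_upwards [eventually_gt_atTop 0] with t ht
    refine ((Real.hasDerivAt_exp t).mul (hy t ht)).congr_deriv ?_
    ring
  · filter_upwards [eventually_gt_atTop 0] with t ht
    refine ((Real.hasDerivAt_exp t).mul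
      (Real.hasDerivAt_rpow_const (p := -b) (Or.inl ht.ne'))).congr_deriv ?_
    rw [rpow_sub_one ht.ne']
    ring
  · filter_upwards [eventually_gt_atTop 0, hq.eventually (lt_mem_nhds zero_lt_one)] with t ht h1
    have := rpow_pos_of_pos ht (-b)
    positivity
  · refine (tendsto_exp_div_rpow_atTop b).congr' ?_
    filter_upwards [eventually_gt_atTop 0] with t ht
    rw [rpow_neg ht.le, div_eq_mul_inv]
  · have h2 := hh.div hq one_ne_zero
    rw [div_one] at h2
    refine h2.congr' ?_
    filter_upwards [eventually_gt_atTop 0] with t ht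
    simp only [Pi.div_apply]
    rw [rpow_neg ht.le, mul_assoc, mul_div_mul_left _ _ (Real.exp_ne_zero t), ← div_div,
      div_inv_eq_mul]

theorem intervalIntegrable_rpow_all {a : ℝ} (ha : -1 < a) (x y : ℝ) :
    IntervalIntegrable (fun r : ℝ => r ^ a) volume x y :=
  intervalIntegral.intervalIntegrable_rpow' ha

/-- `K = t ^ a * e`, where `e` is the exponential kernel. -/
noncomputable def powConv (a : ℝ) : ℝ → ℝ := expConv fun r => r ^ a

/-- `M = t ^ a * e * e`, where `e` is the exponential kernel. -/
noncomputable def powConvTwo (a : ℝ) : ℝ → ℝ := expConv (powConv a)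

theorem continuous_powConv {a : ℝ} (ha : -1 < a) : Continuous (powConv a) :=
  continuous_expConv (intervalIntegrable_rpow_all ha)

theorem continuous_powConvTwo {a : ℝ} (ha : -1 < a) : Continuous (powConvTwo a) :=
  continuous_expConv (fun x y => (continuous_powConv ha).intervalIntegrable x y)

theorem hasDerivAt_powConv {a : ℝ} (ha : -1 < a) {t : ℝ} (ht : 0 < t) :
    HasDerivAt (powConv a) (t ^ a - powConv a t) t :=
  hasDerivAt_expConv (intervalIntegrable_rpow_all ha) (by fun_prop)
    (Real.continuousAt_rpow_const _ _ (Or.inl ht.ne'))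

theorem hasDerivAt_powConvTwo {a : ℝ} (ha : -1 < a) (t : ℝ) :
    HasDerivAt (powConvTwo a) (powConv a t - powConvTwo a t) t :=
  hasDerivAt_expConv (fun x y => (continuous_powConv ha).intervalIntegrable x y)
    (continuous_powConv ha).measurable (continuous_powConv ha).continuousAt

theorem tendsto_powConv_mul {a : ℝ} (ha : -1 < a) :
    Tendsto (fun t => powConv a t * t ^ (-a)) atTop (nhds 1) := by
  refine tendsto_mul_rpow_of_ode (fun t ht => hasDerivAt_powConv ha ht) ?_
  refine tendsto_const_nhds.congr' ?_
  filter_upwards [eventually_gt_atTop 0] with t ht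
  rw [← rpow_add ht]; simp

theorem tendsto_powConvTwo_mul {a : ℝ} (ha : -1 < a) :
    Tendsto (fun t => powConvTwo a t * t ^ (-a)) atTop (nhds 1) :=
  tendsto_mul_rpow_of_ode (fun t _ => hasDerivAt_powConvTwo ha t) (tendsto_powConv_mul ha)

theorem tendsto_const_mul_rpow_mul (c b d : ℝ) (h : d = -b) :
    Tendsto (fun t : ℝ => (c * t ^ b) * t ^ d) atTop (nhds c) := by
  refine tendsto_const_nhds.congr' ?_
  filter_upwards [eventually_gt_atTop 0] with t ht
  rw [mul_assoc, ← rpow_add ht, h]; simp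

theorem tendsto_powConv_sq_sub {a : ℝ} (ha : -1 < a) :
    Tendsto (fun t => (powConv a t ^ 2 - t ^ a * powConvTwo a t) * t ^ (2 - 2 * a))
      atTop (nhds a) := by
  have hK := fun (t : ℝ) (ht : 0 < t) => hasDerivAt_powConv ha ht
  have hM := fun (t : ℝ) => hasDerivAt_powConvTwo ha t
  have hpow : ∀ (b t : ℝ), 0 < t → HasDerivAt (fun t : ℝ => t ^ b) (b * t ^ (b - 1)) t :=
    fun b t ht => Real.hasDerivAt_rpow_const (Or.inl ht.ne')
  have hN1 : Tendsto (fun t => (t ^ a - powConv a t) * t ^ (1 - a)) atTop (nhds a) := by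
    refine tendsto_mul_rpow_of_ode (h := fun t => a * t ^ (a - 1)) (fun t ht => ?_)
      (tendsto_const_mul_rpow_mul _ _ _ (by ring))
    exact (hpow a t ht).sub (hK t ht)
  have hP : Tendsto (fun t => (powConv a t - powConvTwo a t) * t ^ (1 - a)) atTop (nhds a) := by
    refine tendsto_mul_rpow_of_ode (fun t ht => ?_) hN1
    exact (hK t ht).sub (hM t)
  have hN2 : Tendsto (fun t => (a * t ^ (a - 1) - (t ^ a - powConv a t)) * t ^ (2 - a)) atTop
      (nhds (a * (a - 1))) := by
    refine tendsto_mul_rpow_of_ode (h := fun t => a * (a - 1) * t ^ (a - 1 - 1)) (fun t ht => ?_)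
      (tendsto_const_mul_rpow_mul _ _ _ (by ring))
    refine (((hpow (a - 1) t ht).const_mul a).sub ((hpow a t ht).sub (hK t ht))).congr_deriv ?_
    ring
  have hQ : Tendsto (fun t => ((t ^ a - powConv a t) - (powConv a t - powConvTwo a t)) *
      t ^ (2 - a)) atTop (nhds (a * (a - 1))) := by
    refine tendsto_mul_rpow_of_ode (fun t ht => ?_) hN2
    refine (((hpow a t ht).sub (hK t ht)).sub ((hK t ht).sub (hM t))).congr_deriv ?_
    ring
  have h := (hP.mul hP).sub (hQ.mul (tendsto_powConvTwo_mul ha))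
  have e : a * a - a * (a - 1) * 1 = a := by ring
  rw [e] at h
  refine h.congr' ?_
  filter_upwards [eventually_gt_atTop 0] with t ht
  have h1 : t ^ (2 - 2 * a) = t ^ (1 - a) * t ^ (1 - a) := by rw [← rpow_add ht]; ring_nf
  have h2 : t ^ (2 - 2 * a) = t ^ (2 - a) * t ^ (-a) := by rw [← rpow_add ht]; ring_nf
  linear_combination (-(powConv a t - powConvTwo a t) ^ 2) * h1 +
    ((t ^ a - powConv a t) - (powConv a t - powConvTwo a t)) * powConvTwo a t * h2

theorem integrableOn_exp_mul_rpow {b : ℝ} (hb : -1 < b) :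
    IntegrableOn (fun r : ℝ => Real.exp (-r) * r ^ b) (Set.Ioi 0) := by
  simpa using Real.GammaIntegral_convergent (s := b + 1) (by linarith)

theorem integral_exp_mul_rpow {b : ℝ} (hb : -1 < b) :
    ∫ r in Set.Ioi (0:ℝ), Real.exp (-r) * r ^ b = Real.Gamma (b + 1) := by
  rw [Real.Gamma_eq_integral (by linarith)]; simp

theorem integrableOn_exp_mul_add_rpow {b t : ℝ} (hb : -1 < b) (ht : 0 ≤ t) :
    IntegrableOn (fun d : ℝ => Real.exp (-d) * (t + d) ^ b) (Set.Ioi 0) := by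
  have h := (integrableOn_exp_mul_rpow hb).mono_set (Set.Ioi_subset_Ioi ht)
  rw [← (measurePreserving_add_left volume t).integrableOn_comp_preimage
    (measurableEmbedding_addLeft t)] at h
  have hs : (fun d => t + d) ⁻¹' Set.Ioi t = Set.Ioi 0 := by ext; simp
  rw [hs] at h
  refine IntegrableOn.congr_fun (h.const_mul (Real.exp t)) (fun d _ => ?_) measurableSet_Ioi
  simp only [Function.comp]
  rw [← mul_assoc, ← Real.exp_add]
  congr 2; ring

/-- The upper incomplete Gamma function as a shifted integral. -/
theorem exp_mul_Gamma_sub_integral {b t : ℝ} (hb : -1 < b) (ht : 0 ≤ t) :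
    Real.exp t * (Real.Gamma (b + 1) - ∫ r in (0:ℝ)..t, Real.exp (-r) * r ^ b) =
      ∫ d in Set.Ioi (0:ℝ), Real.exp (-d) * (t + d) ^ b := by
  have h := integrableOn_exp_mul_rpow hb
  rw [← integral_exp_mul_rpow hb, ← intervalIntegral.integral_interval_add_Ioi h
    (h.mono_set (Set.Ioi_subset_Ioi ht)), add_sub_cancel_left,
    ← (measurePreserving_add_left volume t).setIntegral_preimage_emb
    (measurableEmbedding_addLeft t)]
  have hs : (fun d => t + d) ⁻¹' Set.Ioi t = Set.Ioi 0 := by ext; simp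
  rw [hs, ← integral_const_mul]
  refine integral_congr_ae (Eventually.of_forall fun d => ?_)
  simp only
  rw [← mul_assoc, ← Real.exp_add]
  congr 2; ring

theorem intervalIntegrable_exp_neg_mul_rpow {b : ℝ} (hb : -1 < b) (x y : ℝ) :
    IntervalIntegrable (fun r : ℝ => Real.exp (-r) * r ^ b) volume x y :=
  (intervalIntegrable_rpow_all hb x y).continuousOn_mul
    (Real.continuous_exp.comp continuous_neg).continuousOn

/-- The upper incomplete Gamma function, scaled by `exp t`. -/
noncomputable def upGamma (b t : ℝ) : ℝ :=
  Real.exp t * (Real.Gamma (b + 1) - ∫ r in (0:ℝ)..t, Real.exp (-r) * r ^ b)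

theorem continuous_upGamma {b : ℝ} (hb : -1 < b) : Continuous (upGamma b) := by
  unfold upGamma
  exact Real.continuous_exp.mul (continuous_const.sub
    (intervalIntegral.continuous_primitive (intervalIntegrable_exp_neg_mul_rpow hb) 0))

theorem hasDerivAt_upGamma {b : ℝ} (hb : -1 < b) {t : ℝ} (ht : 0 < t) :
    HasDerivAt (upGamma b) (upGamma b t - t ^ b) t := by
  have h1 : HasDerivAt (fun t => ∫ r in (0:ℝ)..t, Real.exp (-r) * r ^ b)
      (Real.exp (-t) * t ^ b) t :=
    intervalIntegral.integral_hasDerivAt_right (intervalIntegrable_exp_neg_mul_rpow hb 0 t)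
      (Measurable.stronglyMeasurable (by fun_prop)).stronglyMeasurableAtFilter
      ((Real.continuous_exp.comp continuous_neg).continuousAt.mul
        (Real.continuousAt_rpow_const _ _ (Or.inl ht.ne')))
  refine ((Real.hasDerivAt_exp t).mul (h1.const_sub (Real.Gamma (b + 1)))).congr_deriv ?_
  have : Real.exp (-t) * Real.exp t = 1 := by rw [← Real.exp_add]; simp
  unfold upGamma
  linear_combination (-t ^ b) * this

/-- The function `∫ (t + d) ^ a * (1 - d) * exp (-d) dd` over `d > 0`. -/
noncomputable def upDiff (a t : ℝ) : ℝ := upGamma a t - (upGamma (a + 1) t - t * upGamma a t)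

theorem continuous_upDiff {a : ℝ} (ha : -1 < a) : Continuous (upDiff a) := by
  have h1 := continuous_upGamma ha
  have h2 := continuous_upGamma (b := a + 1) (by linarith)
  unfold upDiff
  fun_prop

theorem hasDerivAt_upDiff {a : ℝ} (ha : -1 < a) {t : ℝ} (ht : 0 < t) :
    HasDerivAt (upDiff a) (upDiff a t - (t ^ a - upGamma a t)) t := by
  have h1 := hasDerivAt_upGamma ha ht
  have h2 := hasDerivAt_upGamma (b := a + 1) (by linarith) ht
  refine (h1.sub (h2.sub ((hasDerivAt_id t).mul h1))).congr_deriv ?_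
  rw [rpow_add_one ht.ne']
  unfold upDiff
  simp only [id]
  ring

theorem upGamma_nonneg {b t : ℝ} (hb : -1 < b) (ht : 0 ≤ t) : 0 ≤ upGamma b t := by
  rw [upGamma, exp_mul_Gamma_sub_integral hb ht]
  refine setIntegral_nonneg measurableSet_Ioi fun d hd => ?_
  have : 0 ≤ (t + d) ^ b := rpow_nonneg (add_nonneg ht (le_of_lt hd)) _
  positivity

theorem upGamma_le {b t : ℝ} (hb : -1 < b) (hb0 : b < 0) (ht : 0 ≤ t) :
    upGamma b t ≤ Real.Gamma (b + 1) := by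
  rw [upGamma, exp_mul_Gamma_sub_integral hb ht, ← integral_exp_mul_rpow hb]
  refine setIntegral_mono_on (integrableOn_exp_mul_add_rpow hb ht)
    (integrableOn_exp_mul_rpow hb) measurableSet_Ioi fun d hd => ?_
  have hd' : (0:ℝ) < d := hd
  exact mul_le_mul_of_nonneg_left
    (rpow_le_rpow_of_nonpos hd' (by linarith) hb0.le) (Real.exp_pos _).le

theorem integrableOn_upDiff_aux {a t : ℝ} (ha : -1 < a) (ht : 0 ≤ t) :
    IntegrableOn (fun d : ℝ => Real.exp (-d) * (t + d) ^ a * d) (Set.Ioi 0) := by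
  have h := (integrableOn_exp_mul_add_rpow (b := a + 1) (by linarith) ht).sub
    ((integrableOn_exp_mul_add_rpow ha ht).const_mul t)
  refine IntegrableOn.congr_fun h (fun d hd => ?_) measurableSet_Ioi
  have : (0:ℝ) < d := hd
  simp only [Pi.sub_apply]
  rw [rpow_add_one (by positivity : t + d ≠ 0)]
  ring

theorem upGamma_succ_sub {a t : ℝ} (ha : -1 < a) (ht : 0 ≤ t) :
    upGamma (a + 1) t - t * upGamma a t =
      ∫ d in Set.Ioi (0:ℝ), Real.exp (-d) * (t + d) ^ a * d := by
  unfold upGamma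
  rw [exp_mul_Gamma_sub_integral (by linarith) ht, exp_mul_Gamma_sub_integral ha ht,
    ← integral_const_mul, ← integral_sub (integrableOn_exp_mul_add_rpow (by linarith) ht)
      ((integrableOn_exp_mul_add_rpow ha ht).const_mul t)]
  refine setIntegral_congr_fun measurableSet_Ioi (fun d hd => ?_)
  have : (0:ℝ) < d := hd
  rw [rpow_add_one (by positivity : t + d ≠ 0)]
  ring

theorem upDiff_eq_integral_sub {a t : ℝ} (ha : -1 < a) (ht : 0 ≤ t) :
    upDiff a t = ∫ d in Set.Ioi (0:ℝ), (Real.exp (-d) * (t + d) ^ a -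
      Real.exp (-d) * (t + d) ^ a * d) := by
  rw [upDiff, upGamma_succ_sub ha ht, upGamma, exp_mul_Gamma_sub_integral ha ht,
    integral_sub (integrableOn_exp_mul_add_rpow ha ht) (integrableOn_upDiff_aux ha ht)]

theorem integrableOn_upDiff {a t : ℝ} (ha : -1 < a) (ht : 0 < t) :
    IntegrableOn (fun d : ℝ => -a * (Real.exp (-d) * (t + d) ^ (a - 1) * d)) (Set.Ioi 0) := by
  refine Integrable.const_mul ?_ _
  refine (integrableOn_exp_mul_add_rpow ha ht.le).mono'
    (Measurable.aestronglyMeasurable (by fun_prop)) ?_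
  refine (ae_restrict_mem measurableSet_Ioi).mono fun d hd => ?_
  have hd' : (0:ℝ) < d := hd
  have h1 : 0 < t + d := by positivity
  have h2 : 0 < (t + d) ^ (a - 1) := rpow_pos_of_pos h1 _
  have h3 : (t + d) ^ a = (t + d) ^ (a - 1) * (t + d) := by
    rw [← rpow_add_one h1.ne']; ring_nf
  rw [Real.norm_of_nonneg (by positivity), h3, mul_assoc]
  gcongr
  linarith

theorem upDiff_eq_integral {a t : ℝ} (ha : -1 < a) (ha0 : a < 0) (ht : 0 < t) :
    upDiff a t = ∫ d in Set.Ioi (0:ℝ), -a * (Real.exp (-d) * (t + d) ^ (a - 1) * d) := by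
  have hi1 : IntegrableOn (fun d => Real.exp (-d) * (t + d) ^ a -
      Real.exp (-d) * (t + d) ^ a * d) (Set.Ioi 0) :=
    (integrableOn_exp_mul_add_rpow ha ht.le).sub (integrableOn_upDiff_aux ha ht.le)
  have hi2 := integrableOn_upDiff ha ht
  rw [upDiff_eq_integral_sub ha ht.le, ← sub_eq_zero, ← integral_sub hi1 hi2]
  have hlim : Tendsto (fun d : ℝ => Real.exp (-d) * (t + d) ^ a * d) atTop (nhds 0) := by
    have h0 : Tendsto (fun d : ℝ => d ^ (a + 1) * Real.exp (-d)) atTop (nhds 0) := by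
      simpa using tendsto_rpow_mul_exp_neg_mul_atTop_nhds_zero (a + 1) 1 one_pos
    refine squeeze_zero' ?_ ?_ h0
    · filter_upwards [eventually_gt_atTop 0] with d hd
      have : 0 ≤ (t + d) ^ a := rpow_nonneg (by positivity) _
      positivity
    · filter_upwards [eventually_gt_atTop 0] with d hd
      rw [rpow_add_one hd.ne']
      have := rpow_le_rpow_of_nonpos hd (by linarith : d ≤ t + d) ha0.le
      calc _ = (t + d) ^ a * (d * Real.exp (-d)) := by ring
        _ ≤ d ^ a * (d * Real.exp (-d)) := by gcongr
        _ = _ := by ring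
  have hderiv : ∀ d ∈ Set.Ici (0:ℝ), HasDerivAt (fun d : ℝ => Real.exp (-d) * (t + d) ^ a * d)
      (Real.exp (-d) * (t + d) ^ a - Real.exp (-d) * (t + d) ^ a * d -
        -a * (Real.exp (-d) * (t + d) ^ (a - 1) * d)) d := by
    intro d hd
    have hd' : (0:ℝ) ≤ d := hd
    have h2 : HasDerivAt (fun d => Real.exp (-d)) (-Real.exp (-d)) d := by
      simpa using (hasDerivAt_neg d).exp
    have h3 : HasDerivAt (fun d => (t + d) ^ a) (a * (t + d) ^ (a - 1)) d := by
      simpa using ((hasDerivAt_id d).const_add t).rpow_const (p := a)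
        (Or.inl (by simp only [id]; positivity))
    refine ((h2.mul h3).mul (hasDerivAt_id d)).congr_deriv ?_
    simp only [id, Pi.mul_apply]
    ring
  rw [integral_Ioi_of_hasDerivAt_of_tendsto' hderiv (hi1.sub hi2) hlim]
  simp

theorem upDiff_nonneg {a t : ℝ} (ha : -1 < a) (ha0 : a < 0) (ht : 0 < t) : 0 ≤ upDiff a t := by
  rw [upDiff_eq_integral ha ha0 ht]
  refine setIntegral_nonneg measurableSet_Ioi fun d hd => ?_
  have hd' : (0:ℝ) < d := hd
  have : 0 ≤ (t + d) ^ (a - 1) := rpow_nonneg (by positivity) _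
  have h2 : 0 ≤ -a := by linarith
  positivity

theorem upDiff_le {a t : ℝ} (ha : -1 < a) (ha0 : a < 0) (ht : 0 ≤ t) :
    upDiff a t ≤ Real.Gamma (a + 1) := by
  refine le_trans ?_ (upGamma_le ha ha0 ht)
  rw [upDiff, upGamma_succ_sub ha ht, sub_le_self_iff]
  refine setIntegral_nonneg measurableSet_Ioi fun d hd => ?_
  have hd' : (0:ℝ) < d := hd
  have : 0 ≤ (t + d) ^ a := rpow_nonneg (by positivity) _
  positivity

theorem integrableOn_rpow_mul_exp_neg_mul {s r : ℝ} (hs : -1 < s) (hr : 0 < r) :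
    IntegrableOn (fun x : ℝ => x ^ s * Real.exp (-(r * x))) (Set.Ioi 0) := by
  have h := Real.integral_rpow_mul_exp_neg_mul_Ioi (a := s + 1) (by linarith) hr
  simp only [add_sub_cancel_right] at h
  refine not_imp_comm.1 integral_undef ?_
  rw [h]
  have := Real.Gamma_pos_of_pos (s := s + 1) (by linarith)
  have h2 : 0 < (1 / r) ^ (s + 1) := rpow_pos_of_pos (by positivity) _
  positivity

theorem lintegral_rpow_mul_exp_neg_mul {s r c : ℝ} (hs : -1 < s) (hr : 0 < r) (hc : 0 ≤ c) :
    ∫⁻ x in Set.Ioi (0:ℝ), ENNReal.ofReal (c * (x ^ s * Real.exp (-(r * x)))) =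
      ENNReal.ofReal (c * (r ^ (-(s + 1)) * Real.Gamma (s + 1))) := by
  have h := Real.integral_rpow_mul_exp_neg_mul_Ioi (a := s + 1) (by linarith) hr
  simp only [add_sub_cancel_right] at h
  rw [← ofReal_integral_eq_lintegral_ofReal
    ((integrableOn_rpow_mul_exp_neg_mul hs hr).const_mul c), integral_const_mul, h, one_div,
    inv_rpow hr.le, rpow_neg hr.le]
  refine (ae_restrict_mem measurableSet_Ioi).mono fun d hd => ?_
  have : 0 ≤ d ^ s := rpow_nonneg (le_of_lt hd) _
  simp only [Pi.zero_apply]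
  positivity

/-- The value of `∫ t ^ a * upDiff a t`. -/
noncomputable def gammaConst (a : ℝ) : ℝ :=
  -a / Real.Gamma (1 - a) * Real.Gamma (a + 1) * Real.Gamma (-2 * a) * Real.Gamma (2 * a + 2)

theorem lintegral_rpow_mul_upDiff {a : ℝ} (ha : -1 < a) (ha0 : a < 0) :
    ∫⁻ t in Set.Ioi (0:ℝ), ENNReal.ofReal (t ^ a * upDiff a t) =
      ENNReal.ofReal (gammaConst a) := by
  have hΓ : 0 < Real.Gamma (1 - a) := Real.Gamma_pos_of_pos (by linarith)
  have hΓ1 : 0 < Real.Gamma (a + 1) := Real.Gamma_pos_of_pos (by linarith)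
  have hΓ2 : 0 < Real.Gamma (-2 * a) := Real.Gamma_pos_of_pos (by linarith)
  have hna : 0 < -a := by linarith
  have hc : 0 < -a / Real.Gamma (1 - a) := by positivity
  set c := -a / Real.Gamma (1 - a) with hcdef
  set G : ℝ → ℝ → ℝ → ENNReal := fun t d l =>
    ENNReal.ofReal (c * t ^ a * (Real.exp (-d) * d) * (l ^ (-a) * Real.exp (-((t + d) * l))))
    with hG
  have step1 : ∀ t ∈ Set.Ioi (0:ℝ), ENNReal.ofReal (t ^ a * upDiff a t) =
      ∫⁻ d in Set.Ioi (0:ℝ), ∫⁻ l in Set.Ioi (0:ℝ), G t d l := by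
    intro t ht
    have ht' : (0:ℝ) < t := ht
    have hta : 0 < t ^ a := rpow_pos_of_pos ht' _
    rw [upDiff_eq_integral ha ha0 ht', ← integral_const_mul, ofReal_integral_eq_lintegral_ofReal
      ((integrableOn_upDiff ha ht').const_mul _)]
    · refine setLIntegral_congr_fun measurableSet_Ioi fun d hd => ?_
      have hd' : (0:ℝ) < d := hd
      simp only [hG]
      rw [lintegral_rpow_mul_exp_neg_mul (by linarith) (by positivity) (by positivity)]
      congr 1
      have e1 : -(-a + 1) = a - 1 := by ring
      have e2 : -a + 1 = 1 - a := by ring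
      rw [e1, e2, hcdef]
      field_simp
    · refine (ae_restrict_mem measurableSet_Ioi).mono fun d hd => ?_
      have hd' : (0:ℝ) < d := hd
      have : 0 ≤ (t + d) ^ (a - 1) := rpow_nonneg (by positivity) _
      simp only [Pi.zero_apply]
      positivity
  have hmeas : Measurable (fun p : ℝ × ℝ × ℝ => G p.1 p.2.1 p.2.2) := by
    simp only [hG]; fun_prop
  rw [setLIntegral_congr_fun measurableSet_Ioi step1, lintegral_lintegral_swap]
  swap
  · refine Measurable.aemeasurable ?_
    simp only [Function.uncurry_def]
    exact Measurable.lintegral_prod_right'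
      (f := fun q : (ℝ × ℝ) × ℝ => G q.1.1 q.1.2 q.2) (by simp only [hG]; fun_prop)
  have step2 : ∀ d ∈ Set.Ioi (0:ℝ),
      ∫⁻ t in Set.Ioi (0:ℝ), ∫⁻ l in Set.Ioi (0:ℝ), G t d l =
      ENNReal.ofReal (c * Real.Gamma (a + 1) * Real.Gamma (-2 * a) *
        (d ^ (2 * a + 1) * Real.exp (-(1 * d)))) := by
    intro d hd
    have hd' : (0:ℝ) < d := hd
    rw [lintegral_lintegral_swap]
    swap
    · refine Measurable.aemeasurable ?_
      simp only [Function.uncurry_def, hG]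
      fun_prop
    have step3 : ∀ l ∈ Set.Ioi (0:ℝ), ∫⁻ t in Set.Ioi (0:ℝ), G t d l =
        ENNReal.ofReal (c * (Real.exp (-d) * d) * Real.Gamma (a + 1) *
          (l ^ (-2 * a - 1) * Real.exp (-(d * l)))) := by
      intro l hl
      have hl' : (0:ℝ) < l := hl
      have hla : 0 < l ^ (-a) := rpow_pos_of_pos hl' _
      have e : ∀ t : ℝ, G t d l = ENNReal.ofReal
          (c * (Real.exp (-d) * d) * (l ^ (-a) * Real.exp (-(d * l))) *
            (t ^ a * Real.exp (-(l * t)))) := by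
        intro t
        simp only [hG]
        congr 1
        have : Real.exp (-((t + d) * l)) = Real.exp (-(d * l)) * Real.exp (-(l * t)) := by
          rw [← Real.exp_add]; ring_nf
        rw [this]; ring
      simp only [e]
      rw [lintegral_rpow_mul_exp_neg_mul ha hl' (by positivity)]
      congr 1
      have : l ^ (-2 * a - 1) = l ^ (-a) * l ^ (-(a + 1)) := by
        rw [← rpow_add hl']; ring_nf
      rw [this]; ring
    rw [setLIntegral_congr_fun measurableSet_Ioi step3,
      lintegral_rpow_mul_exp_neg_mul (by linarith) hd' (by positivity)]
    congr 1
    have e1 : -(-2 * a - 1 + 1) = 2 * a := by ring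
    have e2 : -2 * a - 1 + 1 = -2 * a := by ring
    rw [e1, e2, rpow_add_one hd'.ne', one_mul]
    ring
  rw [setLIntegral_congr_fun measurableSet_Ioi step2,
    lintegral_rpow_mul_exp_neg_mul (by linarith) one_pos (by positivity)]
  congr 1
  have e2 : 2 * a + 1 + 1 = 2 * a + 2 := by ring
  rw [one_rpow, e2, one_mul, gammaConst]

theorem tendsto_integral_rpow_mul_upDiff {a : ℝ} (ha : -1 < a) (ha0 : a < 0) :
    Tendsto (fun T => ∫ t in (0:ℝ)..T, t ^ a * upDiff a t) atTop (nhds (gammaConst a)) := by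
  have hΓ : 0 < Real.Gamma (1 - a) := Real.Gamma_pos_of_pos (by linarith)
  have hΓ1 : 0 < Real.Gamma (a + 1) := Real.Gamma_pos_of_pos (by linarith)
  have hΓ2 : 0 < Real.Gamma (-2 * a) := Real.Gamma_pos_of_pos (by linarith)
  have hΓ3 : 0 < Real.Gamma (2 * a + 2) := Real.Gamma_pos_of_pos (by linarith)
  have hna : 0 < -a := by linarith
  have hpos : 0 ≤ gammaConst a := by unfold gammaConst; positivity
  have hnn : 0 ≤ᵐ[volume.restrict (Set.Ioi 0)] fun t => t ^ a * upDiff a t := by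
    refine (ae_restrict_mem measurableSet_Ioi).mono fun t ht => ?_
    exact mul_nonneg (rpow_nonneg (le_of_lt ht) _) (upDiff_nonneg ha ha0 ht)
  have hm : AEStronglyMeasurable (fun t => t ^ a * upDiff a t)
      (volume.restrict (Set.Ioi 0)) := by
    have := (continuous_upDiff ha).measurable
    exact Measurable.aestronglyMeasurable (by fun_prop)
  have hI : IntegrableOn (fun t => t ^ a * upDiff a t) (Set.Ioi 0) := by
    refine (lintegral_ofReal_ne_top_iff_integrable hm hnn).1 ?_
    rw [lintegral_rpow_mul_upDiff ha ha0]
    exact ENNReal.ofReal_ne_top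
  have := intervalIntegral_tendsto_integral_Ioi 0 hI tendsto_id
  rwa [integral_eq_lintegral_of_nonneg_ae hnn hm, lintegral_rpow_mul_upDiff ha ha0,
    ENNReal.toReal_ofReal hpos] at this

/-- The diagonal integrand left after integrating out both exponential variables over `(0, ∞)`. -/
noncomputable def diagFun (a t : ℝ) : ℝ :=
  t ^ a * (Real.Gamma (a + 1) * (t * Real.exp (-t)) - powConvTwo a t) -
    powConv a t * (Real.Gamma (a + 1) * Real.exp (-t) - powConv a t)

theorem tendsto_rpow_mul_exp_neg (b : ℝ) :
    Tendsto (fun t : ℝ => t ^ b * Real.exp (-t)) atTop (nhds 0) := by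
  simpa using tendsto_rpow_mul_exp_neg_mul_atTop_nhds_zero b 1 one_pos

theorem tendsto_diagFun_mul {a : ℝ} (ha : -1 < a) :
    Tendsto (fun t => diagFun a t * t ^ (2 - 2 * a)) atTop (nhds a) := by
  have h1 := (tendsto_rpow_mul_exp_neg (3 - a)).const_mul (Real.Gamma (a + 1))
  have h2 := ((tendsto_powConv_mul ha).mul (tendsto_rpow_mul_exp_neg (2 - a))).const_mul
    (Real.Gamma (a + 1))
  have h := (h1.sub h2).add (tendsto_powConv_sq_sub ha)
  have e : Real.Gamma (a + 1) * 0 - Real.Gamma (a + 1) * (1 * 0) + a = a := by ring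
  rw [e] at h
  refine h.congr' ?_
  filter_upwards [eventually_gt_atTop 0] with t ht
  have e1 : t ^ (3 - a) = t ^ a * t * t ^ (2 - 2 * a) := by
    rw [← rpow_add_one ht.ne', ← rpow_add ht]; ring_nf
  have e2 : t ^ (2 - 2 * a) = t ^ (-a) * t ^ (2 - a) := by
    rw [← rpow_add ht]; ring_nf
  unfold diagFun
  linear_combination Real.Gamma (a + 1) * Real.exp (-t) * e1 +
    Real.Gamma (a + 1) * Real.exp (-t) * powConv a t * e2

theorem tendsto_rpow_of_neg {a : ℝ} (ha0 : a < 0) :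
    Tendsto (fun t : ℝ => t ^ a) atTop (nhds 0) := by
  simpa using tendsto_rpow_neg_atTop (y := -a) (by linarith)

theorem tendsto_zero_of_mul_rpow {g : ℝ → ℝ} {a : ℝ} (ha0 : a < 0)
    (h : Tendsto (fun t => g t * t ^ (-a)) atTop (nhds 1)) : Tendsto g atTop (nhds 0) := by
  have := h.mul (tendsto_rpow_of_neg ha0)
  rw [mul_zero] at this
  refine this.congr' ?_
  filter_upwards [eventually_gt_atTop 0] with t ht
  rw [mul_assoc, ← rpow_add ht]; simp

/-- The boundary term in the evaluation of the integral of `diagFun`. -/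
noncomputable def boundaryFun (a t : ℝ) : ℝ :=
  Real.Gamma (a + 1) / 2 * (powConv a t * Real.exp (-t)) -
    (powConv a t * upDiff a t - powConvTwo a t * upGamma a t + powConv a t ^ 2 / 2)

theorem continuous_boundaryFun {a : ℝ} (ha : -1 < a) : Continuous (boundaryFun a) := by
  have h1 := continuous_powConv ha
  have h2 := continuous_powConvTwo ha
  have h3 := continuous_upDiff ha
  have h4 := continuous_upGamma ha
  unfold boundaryFun
  fun_prop

theorem boundaryFun_zero (a : ℝ) : boundaryFun a 0 = 0 := by
  simp [boundaryFun, powConv, powConvTwo, expConv_zero]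

theorem hasDerivAt_boundaryFun {a : ℝ} (ha : -1 < a) {t : ℝ} (ht : 0 < t) :
    HasDerivAt (boundaryFun a) (diagFun a t -
      (Real.Gamma (a + 1) * (Real.exp (-t) * t ^ (a + 1)) -
        Real.Gamma (a + 1) / 2 * (Real.exp (-t) * t ^ a) + t ^ a * upDiff a t)) t := by
  have hK := hasDerivAt_powConv ha ht
  have hM := hasDerivAt_powConvTwo ha t
  have hS := hasDerivAt_upDiff ha ht
  have hF := hasDerivAt_upGamma ha ht
  have hE : HasDerivAt (fun t => Real.exp (-t)) (-Real.exp (-t)) t := by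
    simpa using (hasDerivAt_neg t).exp
  refine (((hK.mul hE).const_mul (Real.Gamma (a + 1) / 2)).sub
    (((hK.mul hS).sub (hM.mul hF)).add ((hK.pow 2).div_const 2))).congr_deriv ?_
  rw [rpow_add_one ht.ne']
  unfold diagFun
  simp
  ring

theorem tendsto_boundaryFun {a : ℝ} (ha : -1 < a) (ha0 : a < 0) :
    Tendsto (boundaryFun a) atTop (nhds 0) := by
  have hK := tendsto_zero_of_mul_rpow ha0 (tendsto_powConv_mul ha)
  have hM := tendsto_zero_of_mul_rpow ha0 (tendsto_powConvTwo_mul ha)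
  have hE : Tendsto (fun t : ℝ => Real.exp (-t)) atTop (nhds 0) :=
    Real.tendsto_exp_neg_atTop_nhds_zero
  have hS : Tendsto (fun t => powConv a t * upDiff a t) atTop (nhds 0) := by
    refine bdd_le_mul_tendsto_zero' (Real.Gamma (a + 1)) ?_ hK |>.congr fun t => mul_comm _ _
    filter_upwards [eventually_gt_atTop 0] with t ht
    rw [abs_of_nonneg (upDiff_nonneg ha ha0 ht)]
    exact upDiff_le ha ha0 ht.le
  have hF : Tendsto (fun t => powConvTwo a t * upGamma a t) atTop (nhds 0) := by
    refine bdd_le_mul_tendsto_zero' (Real.Gamma (a + 1)) ?_ hM |>.congr fun t => mul_comm _ _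
    filter_upwards [eventually_gt_atTop 0] with t ht
    rw [abs_of_nonneg (upGamma_nonneg ha ht.le)]
    exact upGamma_le ha ha0 ht.le
  unfold boundaryFun
  simpa using ((hK.mul hE).const_mul (Real.Gamma (a + 1) / 2)).sub
    ((hS.sub hF).add ((hK.pow 2).div_const 2))

theorem intervalIntegrable_diagFun {a : ℝ} (ha : -1 < a) (x y : ℝ) :
    IntervalIntegrable (diagFun a) volume x y := by
  have h1 := continuous_powConv ha
  have h2 := continuous_powConvTwo ha
  unfold diagFun
  refine ((intervalIntegrable_rpow_all ha x y).mul_continuousOn ?_).sub ?_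
  · exact Continuous.continuousOn (by fun_prop)
  · exact Continuous.intervalIntegrable (by fun_prop) _ _

theorem tendsto_integral_exp_mul_rpow {b : ℝ} (hb : -1 < b) :
    Tendsto (fun T => ∫ t in (0:ℝ)..T, Real.exp (-t) * t ^ b) atTop
      (nhds (Real.Gamma (b + 1))) := by
  rw [← integral_exp_mul_rpow hb]
  exact intervalIntegral_tendsto_integral_Ioi 0 (integrableOn_exp_mul_rpow hb) tendsto_id

/-- The limit of the integral of `diagFun`. -/
noncomputable def diagLimit (a : ℝ) : ℝ :=
  Real.Gamma (a + 1) * Real.Gamma (a + 2) - Real.Gamma (a + 1) ^ 2 / 2 + gammaConst a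

theorem tendsto_integral_diagFun {a : ℝ} (ha : -1 < a) (ha0 : a < 0) :
    Tendsto (fun T => ∫ t in (0:ℝ)..T, diagFun a t) atTop (nhds (diagLimit a)) := by
  have h1 := (tendsto_integral_exp_mul_rpow (b := a + 1) (by linarith)).const_mul
    (Real.Gamma (a + 1))
  have h2 := (tendsto_integral_exp_mul_rpow ha).const_mul (Real.Gamma (a + 1) / 2)
  have h3 := tendsto_integral_rpow_mul_upDiff ha ha0
  have h := ((h1.sub h2).add h3).add (tendsto_boundaryFun ha ha0)
  have e : Real.Gamma (a + 1) * Real.Gamma (a + 1 + 1) -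
      Real.Gamma (a + 1) / 2 * Real.Gamma (a + 1) + gammaConst a + 0 = diagLimit a := by
    rw [diagLimit, show a + 1 + 1 = a + 2 by ring]; ring
  rw [e] at h
  refine h.congr' ?_
  filter_upwards [eventually_ge_atTop 0] with T hT
  have i1 := (intervalIntegrable_exp_neg_mul_rpow (b := a + 1) (by linarith) 0 T).const_mul
    (Real.Gamma (a + 1))
  have i2 := (intervalIntegrable_exp_neg_mul_rpow ha 0 T).const_mul (Real.Gamma (a + 1) / 2)
  have i3 : IntervalIntegrable (fun t => t ^ a * upDiff a t) volume 0 T :=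
    (intervalIntegrable_rpow_all ha 0 T).mul_continuousOn (continuous_upDiff ha).continuousOn
  have i4 := intervalIntegrable_diagFun ha 0 T
  have key := intervalIntegral.integral_eq_sub_of_hasDerivAt_of_le hT
    (continuous_boundaryFun ha).continuousOn (fun t ht => hasDerivAt_boundaryFun ha ht.1)
    (i4.sub ((i1.sub i2).add i3))
  rw [intervalIntegral.integral_sub i4 ((i1.sub i2).add i3),
    intervalIntegral.integral_add (i1.sub i2) i3, intervalIntegral.integral_sub i1 i2,
    intervalIntegral.integral_const_mul, intervalIntegral.integral_const_mul,
    boundaryFun_zero] at key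
  linarith

theorem tendsto_integral_diagFun_sub {a : ℝ} (ha : -1 < a) (ha0 : a < 0) :
    Tendsto (fun T => T ^ (1 - 2 * a) * ((∫ t in (0:ℝ)..T, diagFun a t) - diagLimit a)) atTop
      (nhds (-a / (1 - 2 * a))) := by
  have hlim := (tendsto_integral_diagFun ha ha0).sub_const (diagLimit a)
  rw [sub_self] at hlim
  have key := HasDerivAt.lhopital_zero_atTop (l := nhds (-a / (1 - 2 * a)))
    (f := fun T => (∫ t in (0:ℝ)..T, diagFun a t) - diagLimit a) (f' := diagFun a)
    (g := fun T : ℝ => T ^ (2 * a - 1)) (g' := fun T : ℝ => (2 * a - 1) * T ^ (2 * a - 1 - 1))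
    ?_ ?_ ?_ hlim (tendsto_rpow_of_neg (by linarith)) ?_
  · refine key.congr' ?_
    filter_upwards [eventually_gt_atTop 0] with t ht
    rw [show 2 * a - 1 = -(1 - 2 * a) by ring, rpow_neg ht.le, div_inv_eq_mul, mul_comm]
  · filter_upwards [eventually_gt_atTop 0] with t ht
    have h1 := (continuous_powConv ha)
    have h2 := (continuous_powConvTwo ha)
    have h3 := h1.measurable
    have h4 := h2.measurable
    refine (intervalIntegral.integral_hasDerivAt_right (intervalIntegrable_diagFun ha 0 t)
      (Measurable.stronglyMeasurable ?_).stronglyMeasurableAtFilter ?_).sub_const _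
    · unfold diagFun; fun_prop
    · unfold diagFun
      exact ((Real.continuousAt_rpow_const _ _ (Or.inl ht.ne')).mul
        (Continuous.continuousAt (by fun_prop))).sub (Continuous.continuousAt (by fun_prop))
  · filter_upwards [eventually_gt_atTop 0] with t ht
    exact Real.hasDerivAt_rpow_const (Or.inl ht.ne')
  · filter_upwards [eventually_gt_atTop 0] with t ht
    exact mul_ne_zero (by linarith) (rpow_pos_of_pos ht _).ne'
  · have h := (tendsto_diagFun_mul ha).div_const (2 * a - 1)
    have e : a / (2 * a - 1) = -a / (1 - 2 * a) := by
      rw [← neg_div_neg_eq]; ring_nf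
    rw [e] at h
    refine h.congr' ?_
    filter_upwards [eventually_gt_atTop 0] with t ht
    rw [show 2 * a - 1 - 1 = -(2 - 2 * a) by ring, rpow_neg ht.le, mul_comm (2 * a - 1),
      ← div_div, div_inv_eq_mul]

/-- The odd extension of the power function. -/
noncomputable def oddPow (a y : ℝ) : ℝ := Real.sign y * |y| ^ a

theorem measurable_oddPow (a : ℝ) : Measurable (oddPow a) := by
  have hs : Measurable Real.sign :=
    Measurable.ite measurableSet_Iio measurable_const
      (Measurable.ite measurableSet_Ioi measurable_const measurable_const)
  unfold oddPow
  exact hs.mul (by fun_prop)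

theorem abs_oddPow_le (a y : ℝ) : |oddPow a y| ≤ |y| ^ a := by
  have h : 0 ≤ |y| ^ a := rpow_nonneg (abs_nonneg y) _
  rw [oddPow, abs_mul, abs_of_nonneg h]
  obtain h1 | h1 | h1 := Real.sign_apply_eq y <;> simp [h1, h]

theorem oddPow_of_nonneg {a y : ℝ} (ha : a ≠ 0) (hy : 0 ≤ y) : oddPow a y = y ^ a := by
  obtain rfl | h := hy.eq_or_lt
  · simp [oddPow, zero_rpow ha]
  · rw [oddPow, Real.sign_of_pos h, abs_of_pos h, one_mul]

theorem oddPow_of_nonpos {a y : ℝ} (ha : a ≠ 0) (hy : y ≤ 0) : oddPow a y = -(-y) ^ a := by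
  obtain rfl | h := hy.eq_or_lt
  · simp [oddPow, zero_rpow ha]
  · rw [oddPow, Real.sign_of_neg h, abs_of_neg h, neg_one_mul]

theorem intervalIntegrable_abs_rpow {a : ℝ} (ha : -1 < a) (x y : ℝ) :
    IntervalIntegrable (fun r : ℝ => |r| ^ a) volume x y := by
  refine intervalIntegrable_of_even (fun x => by rw [abs_neg]) (fun c hc => ?_)
  refine (intervalIntegrable_rpow_all ha 0 c).congr fun r hr => ?_
  rw [Set.uIoc_of_le hc.le] at hr
  simp only [abs_of_pos hr.1]

theorem exists_integral_abs_sub_rpow_le {a : ℝ} (ha : -1 < a) (ha0 : a < 0) (T : ℝ) :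
    ∃ C, ∀ y, Integrable (fun u : ℝ => |u - y| ^ a) (volume.restrict (Set.Ioc 0 T)) ∧
      ∫ u in Set.Ioc 0 T, |u - y| ^ a ≤ C := by
  set ψ : ℝ → ℝ := (Set.Ioc (-1) 1).indicator (fun r : ℝ => |r| ^ a) with hψ
  have hψi : Integrable ψ := by
    rw [hψ, integrable_indicator_iff measurableSet_Ioc]
    exact (intervalIntegrable_iff_integrableOn_Ioc_of_le (by norm_num)).1
      (intervalIntegrable_abs_rpow ha (-1) 1)
  have hψ0 : ∀ r, 0 ≤ ψ r := fun r =>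
    Set.indicator_nonneg (fun r _ => rpow_nonneg (abs_nonneg r) _) r
  have hle : ∀ r : ℝ, |r| ^ a ≤ 1 + ψ r := by
    intro r
    by_cases hr : r ∈ Set.Ioc (-1:ℝ) 1
    · rw [hψ, Set.indicator_of_mem hr]; linarith
    · rw [hψ, Set.indicator_of_notMem hr, add_zero]
      refine rpow_le_one_of_one_le_of_nonpos ?_ ha0.le
      by_contra! h
      exact hr ⟨(abs_lt.1 h).1, (abs_lt.1 h).2.le⟩
  have hi : ∀ y, Integrable (fun u : ℝ => 1 + ψ (u - y)) (volume.restrict (Set.Ioc 0 T)) :=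
    fun y => (integrable_const (1:ℝ)).add (hψi.comp_sub_right y).restrict
  have hi' : ∀ y, Integrable (fun u : ℝ => |u - y| ^ a) (volume.restrict (Set.Ioc 0 T)) := by
    intro y
    refine (hi y).mono' (Measurable.aestronglyMeasurable (by fun_prop))
      (Eventually.of_forall fun u => ?_)
    rw [Real.norm_of_nonneg (rpow_nonneg (abs_nonneg _) _)]
    exact hle _
  refine ⟨(∫ _ in Set.Ioc 0 T, (1:ℝ)) + ∫ r, ψ r, fun y => ⟨hi' y, ?_⟩⟩
  refine (integral_mono (hi' y) (hi y) fun u => hle _).trans ?_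
  rw [integral_add (integrable_const _) (hψi.comp_sub_right y).restrict]
  gcongr
  rw [← integral_sub_right_eq_self ψ y]
  exact setIntegral_le_integral (hψi.comp_sub_right y) (Eventually.of_forall fun u => hψ0 _)

/-- A kernel dominated by a power singularity, multiplied by an integrable function. -/
theorem integrable_mul_kernel {a T : ℝ} (ha : -1 < a) (ha0 : a < 0) {f : ℝ → ℝ}
    (hf : Integrable f (volume.restrict (Set.Ioc 0 T))) {h : ℝ → ℝ → ℝ}
    (hm : Measurable (Function.uncurry h)) {y : ℝ → ℝ}
    (hb : ∀ t u, 0 < u → |h t u| ≤ |u - y t| ^ a) :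
    Integrable (fun p : ℝ × ℝ => f p.1 * h p.1 p.2)
      ((volume.restrict (Set.Ioc 0 T)).prod (volume.restrict (Set.Ioc 0 T))) := by
  obtain ⟨C, hC⟩ := exists_integral_abs_sub_rpow_le ha ha0 T
  have hb' : ∀ t, ∀ᵐ u ∂(volume.restrict (Set.Ioc 0 T)), ‖h t u‖ ≤ |u - y t| ^ a := fun t =>
    (ae_restrict_mem measurableSet_Ioc).mono fun u hu => hb t u hu.1
  have hms : AEStronglyMeasurable (fun p : ℝ × ℝ => f p.1 * h p.1 p.2)
      ((volume.restrict (Set.Ioc 0 T)).prod (volume.restrict (Set.Ioc 0 T))) :=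
    hf.aestronglyMeasurable.comp_fst.mul hm.aestronglyMeasurable
  have hi : ∀ t, Integrable (h t) (volume.restrict (Set.Ioc 0 T)) := fun t =>
    (hC (y t)).1.mono' (hm.comp measurable_prodMk_left).aestronglyMeasurable (hb' t)
  rw [integrable_prod_iff hms]
  refine ⟨Eventually.of_forall fun t => (hi t).const_mul (f t), ?_⟩
  refine (hf.norm.mul_const C).mono' hms.norm.integral_prod_right'
    (Eventually.of_forall fun t => ?_)
  simp only [norm_mul]
  rw [integral_const_mul, norm_mul, norm_norm,
    Real.norm_of_nonneg (integral_nonneg fun _ => norm_nonneg _)]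
  gcongr
  exact (integral_mono_ae (hi t).norm (hC (y t)).1 (hb' t)).trans (hC (y t)).2

theorem integral_exp_mul_comp_sub (g : ℝ → ℝ) (t : ℝ) :
    ∫ x in (0:ℝ)..t, Real.exp (-x) * g (t - x) = expConv g t := by
  have h := intervalIntegral.integral_comp_sub_left (a := 0) (b := t)
    (fun r => Real.exp (-(t - r)) * g r) t
  simp only [sub_sub_cancel, sub_self, sub_zero] at h
  rw [h, expConv, ← intervalIntegral.integral_const_mul]
  refine intervalIntegral.integral_congr fun r _ => ?_
  rw [← mul_assoc, ← Real.exp_add]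
  congr 2; ring

/-- The integral of `exp (-u) * oddPow a (u - y)` over `u ∈ [0, T]`, for `y ∈ [0, T]`. -/
noncomputable def truncConv (a T y : ℝ) : ℝ :=
  Real.exp (-y) * (∫ w in (0:ℝ)..(T - y), Real.exp (-w) * w ^ a) - powConv a y

theorem continuous_truncConv {a : ℝ} (ha : -1 < a) (T : ℝ) : Continuous (truncConv a T) := by
  have h1 := continuous_powConv ha
  have h2 := (intervalIntegral.continuous_primitive (intervalIntegrable_exp_neg_mul_rpow ha) 0)
  have h3 : Continuous fun y => ∫ w in (0:ℝ)..(T - y), Real.exp (-w) * w ^ a :=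
    h2.comp (continuous_const.sub continuous_id)
  unfold truncConv
  fun_prop

theorem integrable_exp_mul_oddPow {a : ℝ} (ha : -1 < a) (ha0 : a < 0) (T y : ℝ) :
    IntegrableOn (fun u => Real.exp (-u) * oddPow a (u - y)) (Set.Ioc 0 T) := by
  obtain ⟨C, hC⟩ := exists_integral_abs_sub_rpow_le ha ha0 T
  have := measurable_oddPow a
  refine (hC y).1.mono' (Measurable.aestronglyMeasurable (by fun_prop)) ?_
  refine (ae_restrict_mem measurableSet_Ioc).mono fun u hu => ?_
  rw [norm_mul, Real.norm_of_nonneg (Real.exp_pos _).le]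
  have h1 : Real.exp (-u) ≤ 1 := Real.exp_le_one_iff.2 (by linarith [hu.1])
  have h2 := abs_oddPow_le a (u - y)
  calc _ ≤ 1 * |u - y| ^ a := by gcongr; exact h2
    _ = _ := one_mul _

theorem integral_exp_mul_oddPow {a T y : ℝ} (ha : -1 < a) (ha0 : a < 0) (hy : 0 ≤ y)
    (hyT : y ≤ T) :
    ∫ u in Set.Ioc 0 T, Real.exp (-u) * oddPow a (u - y) = truncConv a T y := by
  have hi := integrable_exp_mul_oddPow ha ha0 T y
  rw [← intervalIntegral.integral_of_le (hy.trans hyT)]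
  rw [← intervalIntegrable_iff_integrableOn_Ioc_of_le (hy.trans hyT)] at hi
  have hu : y ∈ Set.uIcc 0 T := by rw [Set.uIcc_of_le (hy.trans hyT)]; exact ⟨hy, hyT⟩
  rw [← intervalIntegral.integral_add_adjacent_intervals
    (hi.mono_set (Set.uIcc_subset_uIcc_left hu)) (hi.mono_set (Set.uIcc_subset_uIcc_right hu))]
  have h1 : ∫ u in (0:ℝ)..y, Real.exp (-u) * oddPow a (u - y) = -powConv a y := by
    rw [powConv, ← integral_exp_mul_comp_sub, ← intervalIntegral.integral_neg]
    refine intervalIntegral.integral_congr fun u hu => ?_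
    rw [Set.uIcc_of_le hy] at hu
    rw [oddPow_of_nonpos ha0.ne (by linarith [hu.2]), neg_sub, mul_neg]
  have h2 : ∫ u in y..T, Real.exp (-u) * oddPow a (u - y) =
      Real.exp (-y) * (∫ w in (0:ℝ)..(T - y), Real.exp (-w) * w ^ a) := by
    have h := intervalIntegral.integral_comp_sub_right (a := y) (b := T)
      (fun w => Real.exp (-(y + w)) * oddPow a w) y
    simp only [sub_self, add_sub_cancel] at h
    rw [h, ← intervalIntegral.integral_const_mul]
    refine intervalIntegral.integral_congr fun w hw => ?_
    rw [Set.uIcc_of_le (by linarith)] at hw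
    rw [oddPow_of_nonneg ha0.ne hw.1, ← mul_assoc, ← Real.exp_add]
    congr 2; ring
  rw [h1, h2, truncConv]; ring

theorem abs_truncConv_sub_le {a T y : ℝ} (ha : -1 < a) (ha0 : a < 0) (hyT : y ≤ T) :
    |truncConv a T y - (Real.Gamma (a + 1) * Real.exp (-y) - powConv a y)| ≤
      Real.Gamma (a + 1) * Real.exp (-T) := by
  have h0 : 0 ≤ T - y := by linarith
  have e : truncConv a T y - (Real.Gamma (a + 1) * Real.exp (-y) - powConv a y) =
      -(Real.exp (-T) * upGamma a (T - y)) := by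
    have : Real.exp (-y) = Real.exp (-T) * Real.exp (T - y) := by
      rw [← Real.exp_add]; ring_nf
    rw [truncConv, upGamma, this]; ring
  rw [e, abs_neg, abs_of_nonneg (mul_nonneg (Real.exp_pos _).le (upGamma_nonneg ha h0)), mul_comm]
  gcongr
  exact upGamma_le ha ha0 h0

theorem expConv_const_mul_exp_sub {a : ℝ} (ha : -1 < a) (c t : ℝ) :
    expConv (fun y => c * Real.exp (-y) - powConv a y) t =
      c * (t * Real.exp (-t)) - powConvTwo a t := by
  have h : ∀ r : ℝ, Real.exp r * (c * Real.exp (-r) - powConv a r) =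
      c - Real.exp r * powConv a r := by
    intro r
    have : Real.exp r * Real.exp (-r) = 1 := by rw [← Real.exp_add]; simp
    linear_combination c * this
  unfold expConv
  simp only [h]
  rw [intervalIntegral.integral_sub (by simp)
    (intervalIntegrable_exp_mul (fun x y => (continuous_powConv ha).intervalIntegrable x y) 0 t),
    intervalIntegral.integral_const, powConvTwo, expConv, smul_eq_mul]
  ring

theorem abs_expConv_le {g : ℝ → ℝ} {t C : ℝ} (ht : 0 ≤ t)
    (hg : ∀ y ∈ Set.Ioc 0 t, |g y| ≤ C) : |expConv g t| ≤ C * t := by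
  rw [expConv, ← intervalIntegral.integral_const_mul]
  have h : ∀ r ∈ Set.uIoc 0 t, ‖Real.exp (-t) * (Real.exp r * g r)‖ ≤ C := by
    intro r hr
    rw [Set.uIoc_of_le ht] at hr
    rw [← mul_assoc, ← Real.exp_add, norm_mul, Real.norm_of_nonneg (Real.exp_pos _).le]
    have h1 : Real.exp (-t + r) ≤ 1 := Real.exp_le_one_iff.2 (by linarith [hr.2])
    calc _ ≤ 1 * |g r| := by gcongr; rfl
      _ ≤ C := by rw [one_mul]; exact hg r hr
  simpa [abs_of_nonneg ht] using intervalIntegral.norm_integral_le_of_norm_le_const h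

theorem powConv_nonneg (a : ℝ) {t : ℝ} (ht : 0 ≤ t) : 0 ≤ powConv a t := by
  refine mul_nonneg (Real.exp_pos _).le (intervalIntegral.integral_nonneg ht fun r hr => ?_)
  exact mul_nonneg (Real.exp_pos _).le (rpow_nonneg hr.1 _)

theorem powConv_le {a t : ℝ} (ha : -1 < a) (ht : 0 ≤ t) : powConv a t ≤ t ^ (a + 1) / (a + 1) := by
  have h : ∫ r in (0:ℝ)..t, r ^ a = t ^ (a + 1) / (a + 1) := by
    rw [integral_rpow (Or.inl ha), zero_rpow (by linarith), sub_zero]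
  rw [← h, powConv, expConv, ← intervalIntegral.integral_const_mul]
  refine intervalIntegral.integral_mono_on ht
    ((intervalIntegrable_exp_mul (intervalIntegrable_rpow_all ha) 0 t).const_mul _)
    (intervalIntegrable_rpow_all ha 0 t) fun r hr => ?_
  rw [← mul_assoc, ← Real.exp_add]
  exact mul_le_of_le_one_left (rpow_nonneg hr.1 _) (Real.exp_le_one_iff.2 (by linarith [hr.2]))

/-- The diagonal integrand for the square `[0, T] × [0, T]`. -/
noncomputable def truncDiag (a T t : ℝ) : ℝ :=
  t ^ a * expConv (truncConv a T) t - powConv a t * truncConv a T t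

theorem intervalIntegrable_truncDiag {a : ℝ} (ha : -1 < a) (T x y : ℝ) :
    IntervalIntegrable (truncDiag a T) volume x y := by
  have h1 := continuous_powConv ha
  have h2 := continuous_truncConv ha T
  have h3 := continuous_expConv (fun x y => h2.intervalIntegrable x y)
  exact ((intervalIntegrable_rpow_all ha x y).mul_continuousOn h3.continuousOn).sub
    ((h1.mul h2).intervalIntegrable x y)

theorem abs_truncDiag_sub_le {a T t : ℝ} (ha : -1 < a) (ha0 : a < 0) (ht : 0 < t) (htT : t ≤ T) :
    |truncDiag a T t - diagFun a t| ≤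
      Real.Gamma (a + 1) * Real.exp (-T) * ((1 + 1 / (a + 1)) * T ^ (a + 1)) := by
  have h2 := continuous_truncConv ha T
  have h1 := continuous_powConv ha
  set p : ℝ → ℝ := fun y => Real.Gamma (a + 1) * Real.exp (-y) - powConv a y with hp
  have hpc : Continuous p := by simp only [hp]; fun_prop
  have hsub : expConv (truncConv a T) t - expConv p t =
      expConv (fun y => truncConv a T y - p y) t := by
    simp only [expConv, mul_sub]
    rw [intervalIntegral.integral_sub, mul_sub]
    · exact (Continuous.intervalIntegrable (by fun_prop) _ _)
    · exact (Continuous.intervalIntegrable (by fun_prop) _ _)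
  have e : truncDiag a T t - diagFun a t =
      t ^ a * expConv (fun y => truncConv a T y - p y) t -
        powConv a t * (truncConv a T t - p t) := by
    rw [← hsub, hp, expConv_const_mul_exp_sub ha, truncDiag, diagFun]; ring
  have hpos : 0 < Real.Gamma (a + 1) := Real.Gamma_pos_of_pos (by linarith)
  have hK := powConv_nonneg a ht.le
  have hta : 0 < t ^ a := rpow_pos_of_pos ht a
  have hK2 := powConv_le ha ht.le
  have b1 : |expConv (fun y => truncConv a T y - p y) t| ≤
      Real.Gamma (a + 1) * Real.exp (-T) * t :=
    abs_expConv_le ht.le fun y hy => abs_truncConv_sub_le ha ha0 (hy.2.trans htT)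
  have b2 : |truncConv a T t - p t| ≤ Real.Gamma (a + 1) * Real.exp (-T) :=
    abs_truncConv_sub_le ha ha0 htT
  rw [e]
  refine (abs_sub _ _).trans ?_
  rw [abs_mul, abs_mul, abs_of_pos hta, abs_of_nonneg hK]
  have ha1 : 0 < a + 1 := by linarith
  have hT : t ^ (a + 1) ≤ T ^ (a + 1) := rpow_le_rpow ht.le htT ha1.le
  calc _ ≤ t ^ a * (Real.Gamma (a + 1) * Real.exp (-T) * t) +
        (t ^ (a + 1) / (a + 1)) * (Real.Gamma (a + 1) * Real.exp (-T)) := by gcongr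
    _ = Real.Gamma (a + 1) * Real.exp (-T) * ((1 + 1 / (a + 1)) * t ^ (a + 1)) := by
      rw [rpow_add_one ht.ne']; ring
    _ ≤ _ := by gcongr

theorem abs_integral_truncDiag_sub_le {a T : ℝ} (ha : -1 < a) (ha0 : a < 0) (hT : 0 < T) :
    |(∫ t in (0:ℝ)..T, truncDiag a T t) - ∫ t in (0:ℝ)..T, diagFun a t| ≤
      Real.Gamma (a + 1) * (1 + 1 / (a + 1)) * (T ^ (a + 2) * Real.exp (-T)) := by
  rw [← intervalIntegral.integral_sub (intervalIntegrable_truncDiag ha T 0 T)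
    (intervalIntegrable_diagFun ha 0 T)]
  rw [← Real.norm_eq_abs]
  refine (intervalIntegral.norm_integral_le_of_norm_le_const (C := Real.Gamma (a + 1) *
    Real.exp (-T) * ((1 + 1 / (a + 1)) * T ^ (a + 1))) fun t ht => ?_).trans_eq ?_
  · rw [Set.uIoc_of_le hT.le] at ht
    exact abs_truncDiag_sub_le ha ha0 ht.1 ht.2
  · rw [sub_zero, abs_of_pos hT, show a + 2 = a + 1 + 1 by ring, rpow_add_one hT.ne' (a + 1)]
    ring

/-- The integrand in the time variable, for fixed space variables. -/
noncomputable def timeIntegrand (a x u t : ℝ) : ℝ :=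
  t ^ a * oddPow a (u - (t - x)) - (t - x) ^ a * oddPow a (u - t)

theorem integrable_sub_rpow {a : ℝ} (ha : -1 < a) {T : ℝ} (hT : 0 ≤ T) (x : ℝ) :
    Integrable (fun t : ℝ => (t - x) ^ a) (volume.restrict (Set.Ioc 0 T)) := by
  have h := (intervalIntegrable_rpow_all ha (0 - x) (T - x)).comp_sub_right x
  simp only [sub_add_cancel] at h
  exact (intervalIntegrable_iff_integrableOn_Ioc_of_le hT).1 h

theorem abs_exp_neg_mul_le {x b : ℝ} {y : ℝ} (hx : 0 < x) (hb : |b| ≤ y) :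
    |Real.exp (-x) * b| ≤ y := by
  rw [abs_mul, abs_of_pos (Real.exp_pos _)]
  exact (mul_le_of_le_one_left (abs_nonneg b) (Real.exp_le_one_iff.2 (by linarith))).trans hb

theorem integral_Ioc_eq_ite {T x : ℝ} (hx : 0 < x) (hxT : x ≤ T) (h : ℝ → ℝ) :
    ∫ t in x..T, h t = ∫ t in Set.Ioc 0 T, (Set.Ioi x).indicator h t := by
  rw [intervalIntegral.integral_of_le hxT, setIntegral_indicator measurableSet_Ioi]
  congr 2
  ext t
  simp only [Set.mem_Ioc, Set.mem_inter_iff, Set.mem_Ioi]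
  exact ⟨fun h => ⟨⟨hx.trans h.1, h.2⟩, h.1⟩, fun h => ⟨h.2, h.1.2⟩⟩

/-- Integrating out the variable `u`. -/
theorem integral_integral_timeIntegrand {a T x : ℝ} (ha : -1 < a) (ha0 : a < 0)
    (hx : 0 < x) (hxT : x ≤ T) :
    ∫ u in Set.Ioc 0 T, Real.exp (-u - x) * ∫ t in x..T, timeIntegrand a x u t =
      ∫ t in Set.Ioc 0 T, (Set.Ioi x).indicator (fun t => Real.exp (-x) *
        (t ^ a * truncConv a T (t - x) - (t - x) ^ a * truncConv a T t)) t := by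
  have hT : 0 ≤ T := hx.le.trans hxT
  have hodd := measurable_oddPow a
  set f₁ : ℝ → ℝ := (Set.Ioi x).indicator fun t => Real.exp (-x) * t ^ a with hf₁
  set f₂ : ℝ → ℝ := (Set.Ioi x).indicator fun t => Real.exp (-x) * (t - x) ^ a with hf₂
  have hi₁ : Integrable f₁ (volume.restrict (Set.Ioc 0 T)) :=
    (((intervalIntegrable_iff_integrableOn_Ioc_of_le hT).1
      (intervalIntegrable_rpow_all ha 0 T)).const_mul _).indicator measurableSet_Ioi
  have hi₂ : Integrable f₂ (volume.restrict (Set.Ioc 0 T)) :=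
    ((integrable_sub_rpow ha hT x).const_mul _).indicator measurableSet_Ioi
  have hk₁ := integrable_mul_kernel ha ha0 hi₁
    (h := fun t u => Real.exp (-u) * oddPow a (u - (t - x))) (y := fun t => t - x)
    (by simp only [Function.uncurry_def]; fun_prop)
    (fun t u hu => abs_exp_neg_mul_le hu (abs_oddPow_le _ _))
  have hk₂ := integrable_mul_kernel ha ha0 hi₂
    (h := fun t u => Real.exp (-u) * oddPow a (u - t)) (y := fun t => t)
    (by simp only [Function.uncurry_def]; fun_prop)
    (fun t u hu => abs_exp_neg_mul_le hu (abs_oddPow_le _ _))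
  have e1 : ∀ u, Real.exp (-u - x) * ∫ t in x..T, timeIntegrand a x u t =
      ∫ t in Set.Ioc 0 T, (f₁ t * (Real.exp (-u) * oddPow a (u - (t - x))) -
        f₂ t * (Real.exp (-u) * oddPow a (u - t))) := by
    intro u
    rw [integral_Ioc_eq_ite hx hxT, ← integral_const_mul]
    refine integral_congr_ae (Eventually.of_forall fun t => ?_)
    simp only [hf₁, hf₂]
    by_cases ht : t ∈ Set.Ioi x
    · simp only [Set.indicator_of_mem ht, timeIntegrand]
      rw [show -u - x = -x + -u by ring, Real.exp_add]; ring
    · simp only [Set.indicator_of_notMem ht]; ring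
  simp only [e1]
  have hswap := integral_integral_swap (f := fun t u =>
    f₁ t * (Real.exp (-u) * oddPow a (u - (t - x))) - f₂ t * (Real.exp (-u) * oddPow a (u - t)))
    (hk₁.sub hk₂)
  rw [← hswap]
  refine setIntegral_congr_fun measurableSet_Ioc fun t ht => ?_
  by_cases hxt : t ∈ Set.Ioi x
  · have hxt' : x < t := hxt
    rw [integral_sub ((integrable_exp_mul_oddPow ha ha0 T _).const_mul _)
      ((integrable_exp_mul_oddPow ha ha0 T _).const_mul _), integral_const_mul,
      integral_const_mul, integral_exp_mul_oddPow ha ha0 (by linarith) (by linarith [ht.2]),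
      integral_exp_mul_oddPow ha ha0 ht.1.le ht.2, hf₁, hf₂]
    simp only [Set.indicator_of_mem hxt]
    ring
  · simp only [hf₁, hf₂, Set.indicator_of_notMem hxt]; simp

theorem integral_square_eq_integral_truncDiag {a T : ℝ} (ha : -1 < a) (ha0 : a < 0) (hT : 0 < T) :
    ∫ x in (0:ℝ)..T, ∫ u in (0:ℝ)..T, Real.exp (-u - x) * ∫ t in x..T, timeIntegrand a x u t =
      ∫ t in (0:ℝ)..T, truncDiag a T t := by
  have hc := continuous_truncConv ha T
  have hcm := hc.measurable
  have hpow : Integrable (fun t : ℝ => t ^ a) (volume.restrict (Set.Ioc 0 T)) :=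
    (intervalIntegrable_iff_integrableOn_Ioc_of_le hT.le).1 (intervalIntegrable_rpow_all ha 0 T)
  have hci : Integrable (truncConv a T) (volume.restrict (Set.Ioc 0 T)) :=
    (intervalIntegrable_iff_integrableOn_Ioc_of_le hT.le).1 (hc.intervalIntegrable 0 T)
  have hset : MeasurableSet {p : ℝ × ℝ | p.2 < p.1} := measurableSet_lt measurable_snd measurable_fst
  have hk₁ : Integrable (fun p : ℝ × ℝ => {p : ℝ × ℝ | p.2 < p.1}.indicator
      (fun p => p.1 ^ a * (Real.exp (-p.2) * truncConv a T (p.1 - p.2))) p)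
      ((volume.restrict (Set.Ioc 0 T)).prod (volume.restrict (Set.Ioc 0 T))) := by
    obtain ⟨C, hC⟩ := (isCompact_Icc (a := -T) (b := T)).exists_bound_of_continuousOn
      hc.continuousOn
    refine Integrable.indicator ?_ hset
    refine (hpow.norm.mul_prod (integrable_const C)).mono'
      (Measurable.aestronglyMeasurable (by fun_prop)) ?_
    rw [Measure.prod_restrict]
    refine (ae_restrict_mem (measurableSet_Ioc.prod measurableSet_Ioc)).mono fun p hp => ?_
    obtain ⟨⟨h1, h2⟩, h3, h4⟩ := hp
    rw [norm_mul]
    gcongr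
    exact abs_exp_neg_mul_le h3 (hC _ ⟨by linarith, by linarith⟩)
  have hk₂ := integrable_mul_kernel ha ha0 hci
    (h := fun t x => {p : ℝ × ℝ | p.2 < p.1}.indicator
      (fun p => Real.exp (-p.2) * (p.1 - p.2) ^ a) (t, x)) (y := fun t => t)
    (by
      simp only [Function.uncurry_def, Prod.mk.eta]
      exact Measurable.indicator (by fun_prop) hset)
    (fun t x hx => by
      have h0 : 0 ≤ |x - t| ^ a := rpow_nonneg (abs_nonneg _) _
      by_cases hxt : (t, x) ∈ {p : ℝ × ℝ | p.2 < p.1}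
      · simp only [Set.indicator_of_mem hxt]
        have hxt' : x < t := hxt
        refine abs_exp_neg_mul_le hx ?_
        rw [abs_of_nonneg (rpow_nonneg (by linarith) _), abs_sub_comm, abs_of_pos (by linarith)]
      · simp only [Set.indicator_of_notMem hxt, abs_zero, h0])
  have hk := hk₁.sub hk₂
  rw [intervalIntegral.integral_of_le hT.le, intervalIntegral.integral_of_le hT.le]
  have e1 : ∀ x ∈ Set.Ioc 0 T, ∫ u in (0:ℝ)..T, Real.exp (-u - x) *
      ∫ t in x..T, timeIntegrand a x u t = ∫ t in Set.Ioc 0 T,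
        ({p : ℝ × ℝ | p.2 < p.1}.indicator
          (fun p => p.1 ^ a * (Real.exp (-p.2) * truncConv a T (p.1 - p.2))) (t, x) -
        truncConv a T t * {p : ℝ × ℝ | p.2 < p.1}.indicator
          (fun p => Real.exp (-p.2) * (p.1 - p.2) ^ a) (t, x)) := by
    intro x hx
    rw [intervalIntegral.integral_of_le hT.le,
      integral_integral_timeIntegrand ha ha0 hx.1 hx.2]
    refine integral_congr_ae (Eventually.of_forall fun t => ?_)
    simp only [Set.indicator_apply, Set.mem_Ioi, Set.mem_ofPred_eq]
    split_ifs <;> ring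
  rw [setIntegral_congr_fun measurableSet_Ioc e1]
  have hswap := integral_integral_swap (f := fun t x =>
    {p : ℝ × ℝ | p.2 < p.1}.indicator
          (fun p => p.1 ^ a * (Real.exp (-p.2) * truncConv a T (p.1 - p.2))) (t, x) -
        truncConv a T t * {p : ℝ × ℝ | p.2 < p.1}.indicator
          (fun p => Real.exp (-p.2) * (p.1 - p.2) ^ a) (t, x)) hk
  rw [← hswap]
  refine setIntegral_congr_fun measurableSet_Ioc fun t ht => ?_
  have e2 : ∀ x, {p : ℝ × ℝ | p.2 < p.1}.indicator
          (fun p => p.1 ^ a * (Real.exp (-p.2) * truncConv a T (p.1 - p.2))) (t, x) -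
        truncConv a T t * {p : ℝ × ℝ | p.2 < p.1}.indicator
          (fun p => Real.exp (-p.2) * (p.1 - p.2) ^ a) (t, x) =
      (Set.Iio t).indicator (fun x => t ^ a * (Real.exp (-x) * truncConv a T (t - x)) -
        truncConv a T t * (Real.exp (-x) * (t - x) ^ a)) x := by
    intro x
    simp only [Set.indicator_apply, Set.mem_Iio, Set.mem_ofPred_eq]
    split_ifs <;> ring
  have hset2 : Set.Ioc 0 T ∩ Set.Iio t = Set.Ioo 0 t := by
    ext x
    simp only [Set.mem_Ioc, Set.mem_inter_iff, Set.mem_Iio, Set.mem_Ioo]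
    exact ⟨fun h => ⟨h.1.1, h.2⟩, fun h => ⟨⟨h.1, h.2.le.trans ht.2⟩, h.2⟩⟩
  simp only [e2]
  rw [setIntegral_indicator measurableSet_Iio, hset2, ← integral_Ioc_eq_integral_Ioo,
    ← intervalIntegral.integral_of_le ht.1.le, intervalIntegral.integral_sub,
    intervalIntegral.integral_const_mul, intervalIntegral.integral_const_mul,
    integral_exp_mul_comp_sub, integral_exp_mul_comp_sub (fun r => r ^ a)]
  · rw [truncDiag, powConv]; ring
  · exact Continuous.intervalIntegrable (by fun_prop) _ _
  · refine IntervalIntegrable.const_mul ?_ _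
    have h := (intervalIntegrable_rpow_all ha t 0).comp_sub_left t
    simp only [sub_self, sub_zero] at h
    exact h.continuousOn_mul (Continuous.continuousOn (by fun_prop))

theorem diagLimit_eq {a : ℝ} (ha : -1 < a) (ha0 : a < 0) :
    diagLimit a = Real.Gamma (a + 1) ^ 2 * ((2 * a + 1) + 2 * Real.Gamma (-2 * a) *
      Real.Gamma (2 * a + 2) / (Real.Gamma (a + 1) * Real.Gamma (-a))) / 2 := by
  have h1 : Real.Gamma (a + 2) = (a + 1) * Real.Gamma (a + 1) := by
    rw [← Real.Gamma_add_one (by linarith)]; ring_nf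
  have h2 : Real.Gamma (1 - a) = -a * Real.Gamma (-a) := by
    rw [← Real.Gamma_add_one (by linarith)]; ring_nf
  have hΓ : Real.Gamma (-a) ≠ 0 := (Real.Gamma_pos_of_pos (by linarith)).ne'
  have hΓ1 : Real.Gamma (a + 1) ≠ 0 := (Real.Gamma_pos_of_pos (by linarith)).ne'
  rw [diagLimit, gammaConst, h1, h2]
  have := ha0.ne
  field_simp
  ring

theorem tendsto_integral_square {a : ℝ} (ha : -1 < a) (ha0 : a < 0) :
    Tendsto (fun T => T ^ (1 - 2 * a) * ((∫ x in (0:ℝ)..T, ∫ u in (0:ℝ)..T, Real.exp (-u - x) *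
      ∫ t in x..T, timeIntegrand a x u t) - diagLimit a)) atTop (nhds (-a / (1 - 2 * a))) := by
  have h0 : Tendsto (fun T => T ^ (1 - 2 * a) * ((∫ t in (0:ℝ)..T, truncDiag a T t) -
      ∫ t in (0:ℝ)..T, diagFun a t)) atTop (nhds 0) := by
    have hb := (tendsto_rpow_mul_exp_neg (3 - a)).const_mul
      (Real.Gamma (a + 1) * (1 + 1 / (a + 1)))
    rw [mul_zero] at hb
    refine squeeze_zero_norm' ?_ hb
    filter_upwards [eventually_gt_atTop 0] with T hT
    have hp : 0 < T ^ (1 - 2 * a) := rpow_pos_of_pos hT _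
    rw [norm_mul, Real.norm_of_nonneg hp.le, Real.norm_eq_abs]
    refine (mul_le_mul_of_nonneg_left (abs_integral_truncDiag_sub_le ha ha0 hT) hp.le).trans_eq ?_
    have : T ^ (3 - a) = T ^ (1 - 2 * a) * T ^ (a + 2) := by rw [← rpow_add hT]; ring_nf
    rw [this]; ring
  have h := h0.add (tendsto_integral_diagFun_sub ha ha0)
  rw [zero_add] at h
  refine h.congr' ?_
  filter_upwards [eventually_gt_atTop 0] with T hT
  rw [integral_square_eq_integral_truncDiag ha ha0 hT]
  ring

theorem stmt_13 (H : ℝ) (hH : H ∈ Set.Ioo (0:ℝ) (1/2))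
    (σsq : ℝ)
    (hσ : σsq = (4 * H - 1) + 2 * Real.Gamma (2 - 4 * H) * Real.Gamma (4 * H) /
        (Real.Gamma (2 * H) * Real.Gamma (1 - 2 * H)))
    (φ4 : ℝ → ℝ → ℝ → ℝ)
    (hφ4 : ∀ T x u : ℝ, φ4 T x u =
      ∫ t in x..T, (t ^ (2 * H - 1) * Real.sign (x + u - t) * |x + u - t| ^ (2 * H - 1) -
        (t - x) ^ (2 * H - 1) * Real.sign (u - t) * |u - t| ^ (2 * H - 1))) :
    ∀ ε : ℝ, 0 < ε → ∀ᶠ T : ℝ in atTop,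
      T ^ (3 - 4 * H) * |(∫ x in (0:ℝ)..T, ∫ u in (0:ℝ)..T, Real.exp (-u - x) * φ4 T x u) -
          Real.Gamma (2 * H) ^ 2 * σsq / 2| ≤ (1 - 2 * H) / (3 - 4 * H) + ε := by
  intro ε hε
  obtain ⟨hH0, hH1⟩ := hH
  obtain ⟨a, rfl⟩ : ∃ a, H = (a + 1) / 2 := ⟨2 * H - 1, by ring⟩
  have ha : -1 < a := by linarith
  have ha0 : a < 0 := by linarith
  rw [show 2 * ((a + 1) / 2) - 1 = a by ring] at hφ4
  rw [show 4 * ((a + 1) / 2) - 1 = 2 * a + 1 by ring, show 2 - 4 * ((a + 1) / 2) = -2 * a by ring,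
    show 4 * ((a + 1) / 2) = 2 * a + 2 by ring, show 2 * ((a + 1) / 2) = a + 1 by ring,
    show 1 - (a + 1) = -a by ring] at hσ
  have hφ : ∀ T x u, φ4 T x u = ∫ t in x..T, timeIntegrand a x u t := by
    intro T x u
    rw [hφ4]
    refine intervalIntegral.integral_congr fun t _ => ?_
    simp only [timeIntegrand, oddPow, show u - (t - x) = x + u - t by ring]
    ring
  rw [show 3 - 4 * ((a + 1) / 2) = 1 - 2 * a by ring, show 2 * ((a + 1) / 2) = a + 1 by ring,
    show 1 - (a + 1) = -a by ring, hσ, ← diagLimit_eq ha ha0]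
  have hlim := (tendsto_integral_square ha ha0).abs
  rw [abs_of_nonneg (div_nonneg (by linarith) (by linarith))] at hlim
  filter_upwards [hlim.eventually (gt_mem_nhds (lt_add_of_pos_right _ hε)),
    eventually_gt_atTop 0] with T hT hT0
  simp only [hφ]
  rw [abs_mul, abs_of_pos (rpow_pos_of_pos hT0 _)] at hT
  exact hT.le
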